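/- arXiv:2304.02755 — 7 statements merged into one kernel-verified Lean document; each statement's English description precedes it below -/
import Mathlib

section
/- Let a > 0. Define the zonotopes Z1 = { ((a/2)ξ1 + (a/2)ξ2, (a/2)ξ1) + (0, a/2) : ξ1, ξ2 ∈ [-1,1] } and Z3 = { ((a/2)ξ1 + (a/2)ξ2, (a/2)ξ1) + (a, a/2) : ξ1, ξ2 ∈ [-1,1] } in ℝ². Then Z1 ∩ Z3 = Φ2, where Φ2 = { (v, v) : 0 ≤ v ≤ a }. -/
/-- For `a > 0`, the intersection of the zonotopes `Z1` (generators
`[[a/2, a/2],[a/2, 0]]`, center `(0, a/2)`) and `Z3` (same generators, center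
`(a, a/2)`) equals `Φ2 = { (v, v) : 0 ≤ v ≤ a }`. -/
theorem zono_inter_eq_phi2 (a : ℝ) (ha : 0 < a) :
    ({ p : ℝ × ℝ | ∃ ξ1 ξ2 : ℝ, |ξ1| ≤ 1 ∧ |ξ2| ≤ 1 ∧
        p = (a / 2 * ξ1 + a / 2 * ξ2 + 0, a / 2 * ξ1 + a / 2) } ∩
      { p : ℝ × ℝ | ∃ ξ1 ξ2 : ℝ, |ξ1| ≤ 1 ∧ |ξ2| ≤ 1 ∧
        p = (a / 2 * ξ1 + a / 2 * ξ2 + a, a / 2 * ξ1 + a / 2) }) =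
    { p : ℝ × ℝ | ∃ v : ℝ, 0 ≤ v ∧ v ≤ a ∧ p = (v, v) } := by
  ext ⟨x, y⟩
  simp only [Set.mem_inter_iff, Set.mem_setOf_eq, Prod.mk.injEq]
  constructor
  · rintro ⟨⟨s, t, hs, ht, hx, hy⟩, ⟨s', t', hs', ht', hx', hy'⟩⟩
    rw [abs_le] at hs ht hs' ht'
    have h1 : a / 2 * t ≤ a / 2 * 1 := mul_le_mul_of_nonneg_left ht.2 (by linarith)
    have h2 : a / 2 * (-1) ≤ a / 2 * t' := mul_le_mul_of_nonneg_left ht'.1 (by linarith)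
    have h3 : a / 2 * s ≤ a / 2 * 1 := mul_le_mul_of_nonneg_left hs.2 (by linarith)
    have h4 : a / 2 * (-1) ≤ a / 2 * s := mul_le_mul_of_nonneg_left hs.1 (by linarith)
    exact ⟨y, by linarith, by linarith, by linarith, rfl⟩
  · rintro ⟨v, h0, h1, rfl, rfl⟩
    have hne : a ≠ 0 := ha.ne'
    have e : a / 2 * (2 * (y / a) - 1) = y - a / 2 := by field_simp
    have b0 : 0 ≤ y / a := by positivity
    have b1 : y / a ≤ 1 := (div_le_one ha).2 h1
    have hb : |2 * (y / a) - 1| ≤ 1 := abs_le.2 ⟨by linarith, by linarith⟩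
    exact ⟨⟨2 * (y / a) - 1, 1, hb, by norm_num, by rw [e]; ring, by rw [e]; ring⟩,
      ⟨2 * (y / a) - 1, -1, hb, by norm_num, by rw [e]; ring, by rw [e]; ring⟩⟩
end

section
/- Let a > 0 and let Φ = { (v, max(0, v)) : v ∈ [-a, a] } ⊂ ℝ² be the graph of the ReLU function over [-a, a]. Define the zonotopes Z1, Z2, Z3 in ℝ², all with generator matrix [[a/2, a/2],[a/2, 0]] and with centers (0, a/2), (-a, -a/2), and (a, a/2), respectively. Then Φ = Z1 ∩ (Z2 ∪ Z3). -/
theorem zono_mem_iff (a : ℝ) (ha : 0 < a) (c d : ℝ) (x y : ℝ) :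
    (∃ ξ1 ξ2 : ℝ, |ξ1| ≤ 1 ∧ |ξ2| ≤ 1 ∧
        (x, y) = (a / 2 * ξ1 + a / 2 * ξ2 + c, a / 2 * ξ1 + d)) ↔
      (|y - d| ≤ a / 2 ∧ |x - c - (y - d)| ≤ a / 2) := by
  have key : ∀ t : ℝ, |a / 2 * t| = a / 2 * |t| := fun t => by
    rw [abs_mul, abs_of_pos (half_pos ha)]
  constructor
  · rintro ⟨s, t, hs, ht, h⟩
    obtain ⟨rfl, rfl⟩ := Prod.mk.inj h
    have e1 : a / 2 * s + d - d = a / 2 * s := by ring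
    have e2 : a / 2 * s + a / 2 * t + c - c - (a / 2 * s + d - d) = a / 2 * t := by ring
    rw [e2, e1, key, key]
    constructor <;> nlinarith
  · rintro ⟨h1, h2⟩
    have h0 : 0 < a / 2 := half_pos ha
    refine ⟨(y - d) / (a / 2), (x - c - (y - d)) / (a / 2), ?_, ?_, ?_⟩
    · rw [abs_div, abs_of_pos h0, div_le_one h0]; exact h1
    · rw [abs_div, abs_of_pos h0, div_le_one h0]; exact h2
    · rw [mul_div_cancel₀ _ h0.ne', mul_div_cancel₀ _ h0.ne']
      ext <;> simp

/-- For `a > 0`, the graph `Φ` of the ReLU function over `[-a, a]`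
equals `Z1 ∩ (Z2 ∪ Z3)`, where `Z1, Z2, Z3` are the zonotopes with generator
matrix `[[a/2, a/2],[a/2, 0]]` and centers `(0, a/2)`, `(-a, -a/2)`, `(a, a/2)`. -/
theorem relu_graph_eq_zono_inter_union (a : ℝ) (ha : 0 < a) :
    { p : ℝ × ℝ | ∃ v : ℝ, -a ≤ v ∧ v ≤ a ∧ p = (v, max 0 v) } =
    { p : ℝ × ℝ | ∃ ξ1 ξ2 : ℝ, |ξ1| ≤ 1 ∧ |ξ2| ≤ 1 ∧
        p = (a / 2 * ξ1 + a / 2 * ξ2 + 0, a / 2 * ξ1 + a / 2) } ∩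
      ({ p : ℝ × ℝ | ∃ ξ1 ξ2 : ℝ, |ξ1| ≤ 1 ∧ |ξ2| ≤ 1 ∧
        p = (a / 2 * ξ1 + a / 2 * ξ2 + -a, a / 2 * ξ1 + -(a / 2)) } ∪
      { p : ℝ × ℝ | ∃ ξ1 ξ2 : ℝ, |ξ1| ≤ 1 ∧ |ξ2| ≤ 1 ∧
        p = (a / 2 * ξ1 + a / 2 * ξ2 + a, a / 2 * ξ1 + a / 2) }) := by
  ext ⟨x, y⟩
  simp only [Set.mem_inter_iff, Set.mem_union, Set.mem_ofPred_eq]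
  rw [zono_mem_iff a ha, zono_mem_iff a ha, zono_mem_iff a ha]
  simp only [abs_le]
  constructor
  · rintro ⟨v, h1, h2, h⟩
    obtain ⟨rfl, rfl⟩ := Prod.mk.inj h
    rcases le_total x 0 with h0 | h0
    · rw [max_eq_left h0]
      refine ⟨⟨⟨?_, ?_⟩, ?_, ?_⟩, Or.inl ⟨⟨?_, ?_⟩, ?_, ?_⟩⟩ <;> linarith
    · rw [max_eq_right h0]
      refine ⟨⟨⟨?_, ?_⟩, ?_, ?_⟩, Or.inr ⟨⟨?_, ?_⟩, ?_, ?_⟩⟩ <;> linarith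
  · rintro ⟨⟨⟨h1, h2⟩, h3, h4⟩, ⟨⟨h5, h6⟩, h7, h8⟩ | ⟨⟨h5, h6⟩, h7, h8⟩⟩
    · have hy : y = 0 := by linarith
      refine ⟨x, by linarith, by linarith, ?_⟩
      rw [max_eq_left (by linarith), hy]
    · have hy : y = x := by linarith
      refine ⟨x, by linarith, by linarith, ?_⟩
      rw [max_eq_right (by linarith), hy]
end

section
/- (Lemma 1) Let a > 0 and let Φ = { (v, max(0, v)) : v ∈ [-a, a] } ⊂ ℝ² be the graph of the ReLU function over the domain [-a, a]. Then Φ equals the hybrid zonotope with continuous generator matrix G^c = [[a/2, a/2, 0, 0],[a/2, 0, 0, 0]] ∈ ℝ^{2×4}, binary generator matrix G^b = [[0],[0]] ∈ ℝ^{2×1}, center c = (0, a/2), constraint matrices A^c = [[a/2, a/2, -a/2, -a/2],[a/2, 0, -a/2, 0]] ∈ ℝ^{2×4} and A^b = [[-a],[-a/2]] ∈ ℝ^{2×1}, and constraint vector b = (0, -a/2). That is, Φ = { G^c ξ^c + G^b ξ^b + c : ξ^c ∈ [-1,1]⁴, ξ^b ∈ {-1,1}, A^c ξ^c + A^b ξ^b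 = b }. In particular, Φ is a hybrid zonotope with 4 continuous generators, 1 binary generator, and 2 constraints. -/
/-- A hybrid zonotope with continuous generator matrix `Gc`, binary generator matrix `Gb`,
center `c`, constraint matrices `Ac`, `Ab`, and constraint vector `b`. -/
def hybZono {ι γ β κ : Type*} [Fintype γ] [Fintype β]
    (Gc : Matrix ι γ ℝ) (Gb : Matrix ι β ℝ) (c : ι → ℝ)
    (Ac : Matrix κ γ ℝ) (Ab : Matrix κ β ℝ) (b : κ → ℝ) : Set (ι → ℝ) :=
  { z | ∃ (ξc : γ → ℝ) (ξb : β → ℝ), (∀ i, |ξc i| ≤ 1) ∧ (∀ i, ξb i = 1 ∨ ξb i = -1) ∧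
      Ac.mulVec ξc + Ab.mulVec ξb = b ∧ z = Gc.mulVec ξc + Gb.mulVec ξb + c }

/-- Lemma 1: The graph `Φ` of the ReLU function over `[-a, a]` is
exactly the hybrid zonotope with the stated data, having 4 continuous generators,
1 binary generator, and 2 constraints. -/
theorem relu_graph_eq_hybZono (a : ℝ) (ha : 0 < a) :
    { z : Fin 2 → ℝ | ∃ v : ℝ, -a ≤ v ∧ v ≤ a ∧ z = ![v, max 0 v] } =
    hybZono
      (!![a/2, a/2, 0, 0; a/2, 0, 0, 0] : Matrix (Fin 2) (Fin 4) ℝ)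
      (!![(0 : ℝ); 0] : Matrix (Fin 2) (Fin 1) ℝ)
      (![0, a/2] : Fin 2 → ℝ)
      (!![a/2, a/2, -(a/2), -(a/2); a/2, 0, -(a/2), 0] : Matrix (Fin 2) (Fin 4) ℝ)
      (!![-a; -(a/2)] : Matrix (Fin 2) (Fin 1) ℝ)
      (![0, -(a/2)] : Fin 2 → ℝ) := by
  ext z
  simp only [hybZono, Set.mem_setOf_eq]
  constructor
  · rintro ⟨v, h1, h2, rfl⟩
    rcases le_total 0 v with hv | hv
    · have e1 : v / a ≤ 1 := (div_le_one ha).2 h2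
      have e2 : 0 ≤ v / a := div_nonneg hv ha.le
      have e3 : a * (v / a) = v := by field_simp
      refine ⟨![2 * (v / a) - 1, 1, 2 * (v / a) - 1, -1], ![1], ?_, ?_, ?_, ?_⟩
      · intro i
        rw [abs_le]
        fin_cases i <;> constructor <;> simp <;> linarith
      · intro i
        fin_cases i
        simp
      · ext i
        fin_cases i <;> simp [Matrix.mulVec, dotProduct, Fin.sum_univ_succ] <;> ring
      · rw [max_eq_right hv]
        ext i
        fin_cases i <;> simp [Matrix.mulVec, dotProduct, Fin.sum_univ_succ] <;> linarith
    · have e1 : -1 ≤ v / a := (le_div_iff₀ ha).2 (by linarith)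
      have e2 : v / a ≤ 0 := div_nonpos_of_nonpos_of_nonneg hv ha.le
      have e3 : a * (v / a) = v := by field_simp
      refine ⟨![-1, 2 * (v / a) + 1, 1, 2 * (v / a) + 1], ![-1], ?_, ?_, ?_, ?_⟩
      · intro i
        rw [abs_le]
        fin_cases i <;> constructor <;> simp <;> linarith
      · intro i
        fin_cases i
        simp
      · ext i
        fin_cases i <;> simp [Matrix.mulVec, dotProduct, Fin.sum_univ_succ] <;> ring
      · rw [max_eq_left hv]
        ext i
        fin_cases i <;> simp [Matrix.mulVec, dotProduct, Fin.sum_univ_succ] <;> linarith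
  · rintro ⟨x, s, hx, hs, hc, rfl⟩
    have c0 := congrFun hc 0
    have c1 := congrFun hc 1
    simp [Matrix.mulVec, dotProduct, Fin.sum_univ_four] at c0 c1
    have x0 := abs_le.1 (hx 0)
    have x1 := abs_le.1 (hx 1)
    have x2 := abs_le.1 (hx 2)
    have x3 := abs_le.1 (hx 3)
    have k1 : x 0 - x 2 = s 0 - 1 := by
      apply mul_left_cancel₀ ha.ne'
      linarith
    have k0 : x 1 - x 3 = s 0 + 1 := by
      apply mul_left_cancel₀ ha.ne'
      linarith
    rcases hs 0 with h | h
    · rw [h] at k0 k1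
      have y1 : x 1 = 1 := by linarith
      have hv : 0 ≤ a / 2 * (x 0 + 1) := mul_nonneg (by linarith) (by linarith)
      refine ⟨a / 2 * (x 0 + 1), by linarith, by nlinarith, ?_⟩
      rw [max_eq_right hv]
      ext i
      fin_cases i <;> simp [Matrix.mulVec, dotProduct, Fin.sum_univ_four, y1] <;> ring
    · rw [h] at k0 k1
      have y0 : x 0 = -1 := by linarith
      have hv : a / 2 * (x 1 - 1) ≤ 0 :=
        mul_nonpos_of_nonneg_of_nonpos (by linarith) (by linarith)
      refine ⟨a / 2 * (x 1 - 1), by nlinarith, by linarith, ?_⟩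
      rw [max_eq_left hv]
      ext i
      fin_cases i <;> simp [Matrix.mulVec, dotProduct, Fin.sum_univ_four, y0] <;> ring
end

section
/- Let a > 0 and p ≥ 1. The graph of the elementwise ReLU map over the box [-a, a]^p, namely the set { (v, φ(v)) ∈ ℝ^p × ℝ^p : v ∈ [-a, a]^p } where φ(v)_i = max(0, v_i) for each i, can be represented exactly as a hybrid zonotope with 4p continuous generators, p binary generators, and 2p constraints: there exist matrices G^c ∈ ℝ^{2p×4p}, G^b ∈ ℝ^{2p×p}, c ∈ ℝ^{2p}, A^c ∈ ℝ^{2p×4p}, A^b ∈ ℝ^{2p×p}, and b ∈ ℝ^{2p} such that { (v, φ(v)) : v ∈ [-a,a]^p } = { G^c ξ^c + G^b ξ^b + c : ξ^c ∈ [-1,1]^{4p}, ξ^b ∈ {-1,1}^{p}, A^c ξ^c + A^b ξ^b = b }. -/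
theorem relu_sum_aux (p : ℕ) (w : Fin 4 → ℝ) (i : Fin p) (x : Fin (4 * p) → ℝ) :
    (∑ k : Fin (4 * p), (if (finProdFinEquiv.symm k).2 = i then
      w (finProdFinEquiv.symm k).1 else 0) * x k) =
    w 0 * x (finProdFinEquiv (0, i)) + w 1 * x (finProdFinEquiv (1, i)) +
      w 2 * x (finProdFinEquiv (2, i)) + w 3 * x (finProdFinEquiv (3, i)) := by
  rw [← Equiv.sum_comp (finProdFinEquiv (m := 4) (n := p)), Fintype.sum_prod_type]
  simp [Fin.sum_univ_four]

/-- The graph of the elementwise ReLU map over the box `[-a, a]^p`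
(identifying `ℝ^p × ℝ^p` with functions on `Fin p ⊕ Fin p`) is exactly representable
as a hybrid zonotope with `4p` continuous generators, `p` binary generators, and
`2p` constraints. -/
theorem relu_layer_graph_eq_hybZono (a : ℝ) (ha : 0 < a) (p : ℕ) (hp : 1 ≤ p) :
    ∃ (Gc : Matrix (Fin p ⊕ Fin p) (Fin (4 * p)) ℝ)
      (Gb : Matrix (Fin p ⊕ Fin p) (Fin p) ℝ)
      (c : Fin p ⊕ Fin p → ℝ)
      (Ac : Matrix (Fin (2 * p)) (Fin (4 * p)) ℝ)
      (Ab : Matrix (Fin (2 * p)) (Fin p) ℝ)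
      (b : Fin (2 * p) → ℝ),
    { z : Fin p ⊕ Fin p → ℝ | ∃ v : Fin p → ℝ, (∀ i, -a ≤ v i ∧ v i ≤ a) ∧
        z = Sum.elim v (fun i => max 0 (v i)) } =
    hybZono Gc Gb c Ac Ab b := by
  let e2 := finProdFinEquiv (m := 2) (n := p)
  let e4 := finProdFinEquiv (m := 4) (n := p)
  refine ⟨fun r k => Sum.elim
      (fun i => if (finProdFinEquiv.symm k).2 = i then
        (![a/2, -(a/2), 0, 0] : Fin 4 → ℝ) (finProdFinEquiv.symm k).1 else 0)
      (fun i => if (finProdFinEquiv.symm k).2 = i then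
        (![a/2, 0, 0, 0] : Fin 4 → ℝ) (finProdFinEquiv.symm k).1 else 0) r,
    0, Sum.elim (fun _ => 0) (fun _ => a/2),
    fun r k => if (finProdFinEquiv.symm k).2 = (e2.symm r).2 then
        ((![![1, 0, 1, 0], ![0, 1, 0, 1]] : Fin 2 → Fin 4 → ℝ) (e2.symm r).1)
          (finProdFinEquiv.symm k).1 else 0,
    fun r k => if k = (e2.symm r).2 then (![-1, 1] : Fin 2 → ℝ) (e2.symm r).1 else 0,
    fun _ => -1, ?_⟩
  ext z
  simp only [hybZono, Set.mem_setOf_eq]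
  -- unfold the constraints and the output map coordinatewise
  have key : ∀ (x : Fin (4 * p) → ℝ) (s : Fin p → ℝ),
      ((∀ r : Fin (2 * p), (∑ k : Fin (4 * p), (if (finProdFinEquiv.symm k).2 = (e2.symm r).2 then
        ((![![1, 0, 1, 0], ![0, 1, 0, 1]] : Fin 2 → Fin 4 → ℝ) (e2.symm r).1)
          (finProdFinEquiv.symm k).1 else 0) * x k) +
        (∑ k, (if k = (e2.symm r).2 then (![-1, 1] : Fin 2 → ℝ) (e2.symm r).1 else 0) * s k)
          = -1) ↔
      ∀ i, x (e4 (0, i)) + x (e4 (2, i)) - s i = -1 ∧ x (e4 (1, i)) + x (e4 (3, i)) + s i = -1) := by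
    intro x s
    rw [← e2.forall_congr_right]
    simp only [relu_sum_aux, Equiv.symm_apply_apply, Prod.forall, Fin.forall_fin_two]
    rw [← forall_and]
    refine forall_congr' fun i => ?_
    simp [e4, sub_eq_add_neg]
  constructor
  · rintro ⟨v, hv, rfl⟩
    refine ⟨fun k => (fun q : Fin 4 × Fin p =>
      (![2 * max 0 (v q.2) / a - 1, 2 * max 0 (-v q.2) / a - 1,
        (if 0 ≤ v q.2 then 1 - 2 * max 0 (v q.2) / a else -1),
        (if 0 ≤ v q.2 then -1 else 1 - 2 * max 0 (-v q.2) / a)] : Fin 4 → ℝ) q.1) (e4.symm k),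
      fun i => if 0 ≤ v i then 1 else -1, ?_, ?_, ?_, ?_⟩
    · rw [← e4.forall_congr_right]
      simp only [Equiv.symm_apply_apply, Prod.forall]
      have hb : ∀ t : ℝ, -a ≤ t → t ≤ a → 0 ≤ 2 * max 0 t / a ∧ 2 * max 0 t / a ≤ 2 := by
        intro t h1 h2
        refine ⟨by positivity, ?_⟩
        rw [div_le_iff₀ ha]
        have := max_le ha.le h2
        linarith
      intro j i
      obtain ⟨h1, h2⟩ := hb (v i) (hv i).1 (hv i).2
      obtain ⟨h3, h4⟩ := hb (-v i) (by linarith [(hv i).2]) (by linarith [(hv i).1])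
      rw [abs_le]
      fin_cases j <;> simp <;> (try split_ifs) <;> constructor <;> linarith
    · intro i
      by_cases h : 0 ≤ v i <;> simp [h]
    · funext r
      revert r
      refine (key _ _).2 fun i => ?_
      by_cases h : 0 ≤ v i
      · simp [h]
      · have h' : v i ≤ 0 := by linarith
        simp [h, h']
    · funext r
      have ha' : a ≠ 0 := ha.ne'
      rcases r with i | i
      · simp only [Pi.add_apply, Matrix.mulVec, dotProduct, Sum.elim_inl, relu_sum_aux]
        rcases le_total 0 (v i) with h | h <;> simp [h, e4] <;> field_simp <;> ring
      · simp only [Pi.add_apply, Matrix.mulVec, dotProduct, Sum.elim_inr, relu_sum_aux]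
        rcases le_total 0 (v i) with h | h <;> simp [h, e4] <;> field_simp <;> ring
  · rintro ⟨x, s, hx, hs, hc, rfl⟩
    have hc' := (key x s).1 (fun r => congrFun hc r)
    have hxx : ∀ k, -1 ≤ x k ∧ x k ≤ 1 := fun k => abs_le.1 (hx k)
    have h0 : ∀ i, 0 ≤ a * (x (e4 (0, i)) + 1) := fun i =>
      mul_nonneg ha.le (by linarith [(hxx (e4 (0, i))).1])
    have h1 : ∀ i, 0 ≤ a * (x (e4 (1, i)) + 1) := fun i =>
      mul_nonneg ha.le (by linarith [(hxx (e4 (1, i))).1])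
    have h0' : ∀ i, 0 ≤ a * (1 - x (e4 (0, i))) := fun i =>
      mul_nonneg ha.le (by linarith [(hxx (e4 (0, i))).2])
    have h1' : ∀ i, 0 ≤ a * (1 - x (e4 (1, i))) := fun i =>
      mul_nonneg ha.le (by linarith [(hxx (e4 (1, i))).2])
    refine ⟨fun i => a / 2 * (x (e4 (0, i)) - x (e4 (1, i))), ?_, ?_⟩
    · intro i
      constructor <;> linarith [h0 i, h1 i, h0' i, h1' i]
    · funext r
      rcases r with i | i
      · simp only [Pi.add_apply, Matrix.mulVec, dotProduct, Sum.elim_inl, relu_sum_aux]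
        simp [e4]
        ring
      · simp only [Pi.add_apply, Matrix.mulVec, dotProduct, Sum.elim_inr, relu_sum_aux]
        obtain ⟨c1, c2⟩ := hc' i
        rcases hs i with h | h
        · have hh : x (e4 (1, i)) = -1 := by
            linarith [(hxx (e4 (1, i))).1, (hxx (e4 (3, i))).1]
          rw [max_eq_right (by rw [hh]; linarith [h0 i])]
          rw [hh]
          simp [e4]
          ring
        · have hh : x (e4 (0, i)) = -1 := by
            linarith [(hxx (e4 (0, i))).1, (hxx (e4 (2, i))).1]
          rw [max_eq_left (by rw [hh]; linarith [h1 i])]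
          simp only [e4] at hh
          simp [hh]
end

section
/- (Corollary 1) Let f : ℝ^n → ℝ^m be an L-layered feed-forward fully connected ReLU neural network with weights W^ℓ, biases b^ℓ, and a total of n_N ReLU neurons, and let a > 0 be such that all pre-activation vectors lie in [-a, a]^{n_{ℓ+1}} whenever the input x lies in [-a, a]^n. Let X ⊆ [-a, a]^n be a hybrid zonotope with n_{g,x} continuous generators, n_{b,x} binary generators, and n_{c,x} constraints. Then the image set Y = { f(x) : x ∈ X } ⊆ ℝ^m is a hybrid zonotope with n_{g,y} = n_{g,x} + 4 n_N continuous generators, n_{b,y} = n_{b,x} + n_N binary generators, and n_{c,y} = n + n_{c,x} + 3 n_N constraints: there exist hybrid zonotope data of those dimensions whose associated set equals Y. -/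
/-- Layer values `x^ℓ` of a feed-forward fully connected ReLU network:
`x^0 = x` and `x^{ℓ+1} = φ(W^ℓ x^ℓ + b^ℓ)` with `φ` the elementwise ReLU. -/
noncomputable def nnLayer (dims : ℕ → ℕ)
    (W : ∀ ℓ, Matrix (Fin (dims (ℓ + 1))) (Fin (dims ℓ)) ℝ)
    (bv : ∀ ℓ, Fin (dims (ℓ + 1)) → ℝ)
    (x : Fin (dims 0) → ℝ) : ∀ ℓ, Fin (dims ℓ) → ℝ
  | 0 => x
  | ℓ + 1 => fun i => max 0 ((W ℓ).mulVec (nnLayer dims W bv x ℓ) i + bv ℓ i)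

/-- The output `f(x) = W^L x^L + b^L` of an `L`-layered feed-forward fully connected
ReLU neural network with weights `W`, biases `bv`, and layer widths `dims`. -/
noncomputable def nnFun (L : ℕ) (dims : ℕ → ℕ)
    (W : ∀ ℓ, Matrix (Fin (dims (ℓ + 1))) (Fin (dims ℓ)) ℝ)
    (bv : ∀ ℓ, Fin (dims (ℓ + 1)) → ℝ)
    (x : Fin (dims 0) → ℝ) : Fin (dims (L + 1)) → ℝ :=
  (W L).mulVec (nnLayer dims W bv x L) + bv L

/-- `S` is a hybrid zonotope with `g` continuous generators, `b` binary generators and `k`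
constraints. -/
def IsHZ {ι : Type} (S : Set (ι → ℝ)) (g b k : ℕ) : Prop :=
  ∃ (Gc : Matrix ι (Fin g) ℝ) (Gb : Matrix ι (Fin b) ℝ) (c : ι → ℝ)
    (Ac : Matrix (Fin k) (Fin g) ℝ) (Ab : Matrix (Fin k) (Fin b) ℝ) (bb : Fin k → ℝ),
    S = hybZono Gc Gb c Ac Ab bb

/-- Reindexing the data by `Fin`. -/
lemma IsHZ.of_fintype {ι γ β κ : Type} [Fintype γ] [Fintype β] [Fintype κ] {g b k : ℕ}
    (eg : γ ≃ Fin g) (eb : β ≃ Fin b) (ek : κ ≃ Fin k)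
    (Gc : Matrix ι γ ℝ) (Gb : Matrix ι β ℝ) (c : ι → ℝ)
    (Ac : Matrix κ γ ℝ) (Ab : Matrix κ β ℝ) (bb : κ → ℝ) :
    IsHZ (hybZono Gc Gb c Ac Ab bb) g b k := by
  refine ⟨Gc.submatrix id eg.symm, Gb.submatrix id eb.symm, c,
    Ac.submatrix ek.symm eg.symm, Ab.submatrix ek.symm eb.symm, bb ∘ ek.symm, ?_⟩
  ext z
  simp only [hybZono, Set.mem_ofPred_eq, Matrix.submatrix_mulVec_equiv, Equiv.symm_symm]
  constructor
  · rintro ⟨u, v, hu, hv, h1, h2⟩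
    refine ⟨u ∘ eg.symm, v ∘ eb.symm, fun i => hu _, fun i => hv _, ?_, ?_⟩
    · subst h1
      ext i
      simp [Function.comp_assoc]
    · subst h2
      ext i
      simp [Function.comp_assoc]
  · rintro ⟨u, v, hu, hv, h1, h2⟩
    refine ⟨u ∘ eg, v ∘ eb, fun i => hu _, fun i => hv _, ?_, ?_⟩
    · ext i
      have := congrFun h1 (ek i)
      simpa using this
    · subst h2
      ext i
      simp

/-- Affine images. -/
lemma IsHZ.affine {ι ι' : Type} [Fintype ι] {S : Set (ι → ℝ)} {g b k : ℕ}
    (h : IsHZ S g b k) (M : Matrix ι' ι ℝ) (t : ι' → ℝ) :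
    IsHZ ((fun x => M.mulVec x + t) '' S) g b k := by
  obtain ⟨Gc, Gb, c, Ac, Ab, bb, rfl⟩ := h
  refine ⟨M * Gc, M * Gb, M.mulVec c + t, Ac, Ab, bb, ?_⟩
  ext z
  simp only [hybZono, Set.mem_ofPred_eq, Set.mem_image]
  constructor
  · rintro ⟨x, ⟨u, v, hu, hv, h1, rfl⟩, rfl⟩
    refine ⟨u, v, hu, hv, h1, ?_⟩
    simp only [Matrix.mulVec_add, Matrix.mulVec_mulVec]
    abel
  · rintro ⟨u, v, hu, hv, h1, rfl⟩
    refine ⟨_, ⟨u, v, hu, hv, h1, rfl⟩, ?_⟩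
    simp only [Matrix.mulVec_add, Matrix.mulVec_mulVec]
    abel

/-- Padding with trivial constraints. -/
lemma IsHZ.pad {ι : Type} {S : Set (ι → ℝ)} {g b k : ℕ}
    (h : IsHZ S g b k) (n : ℕ) : IsHZ S g b (n + k) := by
  obtain ⟨Gc, Gb, c, Ac, Ab, bb, rfl⟩ := h
  have : hybZono Gc Gb c Ac Ab bb =
      hybZono Gc Gb c (Matrix.fromRows (0 : Matrix (Fin n) (Fin g) ℝ) Ac)
        (Matrix.fromRows (0 : Matrix (Fin n) (Fin b) ℝ) Ab) (Sum.elim 0 bb) := by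
    ext z
    simp only [hybZono, Set.mem_ofPred_eq, Matrix.fromRows_mulVec]
    have key : ∀ (u : Fin g → ℝ) (v : Fin b → ℝ),
        (Sum.elim ((0 : Matrix (Fin n) (Fin g) ℝ).mulVec u) (Ac.mulVec u) +
          Sum.elim ((0 : Matrix (Fin n) (Fin b) ℝ).mulVec v) (Ab.mulVec v) = Sum.elim (0 : Fin n → ℝ) bb) ↔
        Ac.mulVec u + Ab.mulVec v = bb := by
      intro u v
      simp [funext_iff]
    simp only [key]
  rw [this]
  exact IsHZ.of_fintype (Equiv.refl _) (Equiv.refl _) finSumFinEquiv _ _ _ _ _ _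

/-- Image under the elementwise ReLU. -/
lemma IsHZ.relu {d : ℕ} {S : Set (Fin d → ℝ)} {g b k : ℕ} (h : IsHZ S g b k)
    (a : ℝ) (ha : 0 < a) (hS : ∀ x ∈ S, ∀ i, -a ≤ x i ∧ x i ≤ a) :
    IsHZ ((fun x i => max 0 (x i)) '' S) (g + 4 * d) (b + d) (k + 3 * d) := by
  obtain ⟨Gc, Gb, c, Ac, Ab, bb, rfl⟩ := h
  let D := Fin d
  let I : Matrix D D ℝ := 1
  let O : Matrix D D ℝ := 0
  let Zg : Matrix D (Fin g) ℝ := 0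
  let Zb : Matrix D (Fin b) ℝ := 0
  let Z4 : Matrix (Fin k) (D ⊕ (D ⊕ (D ⊕ D))) ℝ := 0
  let Zk : Matrix (Fin k) D ℝ := 0
  let r4 (A B C E : Matrix D D ℝ) : Matrix D (D ⊕ (D ⊕ (D ⊕ D))) ℝ :=
    Matrix.fromCols A (Matrix.fromCols B (Matrix.fromCols C E))
  have e4 : Fin g ⊕ (D ⊕ (D ⊕ (D ⊕ D))) ≃ Fin (g + 4 * d) :=
    Fintype.equivFinOfCardEq (by simp [D]; ring)
  have e1 : Fin b ⊕ D ≃ Fin (b + d) := Fintype.equivFinOfCardEq (by simp [D])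
  have e3 : Fin k ⊕ (D ⊕ (D ⊕ D)) ≃ Fin (k + 3 * d) :=
    Fintype.equivFinOfCardEq (by simp [D]; ring)
  suffices hh : (fun (x : Fin d → ℝ) i => max 0 (x i)) '' hybZono Gc Gb c Ac Ab bb =
      hybZono (Matrix.fromCols Zg (r4 ((a / 2) • I) O O O)) (Matrix.fromCols Zb O)
        (fun _ => a / 2)
        (Matrix.fromRows (Matrix.fromCols Ac Z4)
          (Matrix.fromRows (Matrix.fromCols Zg (r4 I O I O))
            (Matrix.fromRows (Matrix.fromCols Zg (r4 O I O I))
              (Matrix.fromCols (-Gc) (r4 ((a / 2) • I) ((-(a / 2)) • I) O O)))))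
        (Matrix.fromRows (Matrix.fromCols Ab Zk)
          (Matrix.fromRows (Matrix.fromCols Zb (-I))
            (Matrix.fromRows (Matrix.fromCols Zb I)
              (Matrix.fromCols (-Gb) O))))
        (Sum.elim bb (Sum.elim (fun _ => -1) (Sum.elim (fun _ => -1) c))) by
    rw [hh]
    exact IsHZ.of_fintype e4 e1 e3 _ _ _ _ _ _
  ext z
  simp only [hybZono, Set.mem_ofPred_eq, Set.mem_image, Matrix.fromRows_mulVec,
    Matrix.fromCols_mulVec, r4, Zg, Zb, Z4, Zk, I, O, Matrix.zero_mulVec, Matrix.one_mulVec,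
    Matrix.smul_mulVec, Matrix.neg_mulVec, add_zero, zero_add]
  constructor
  · rintro ⟨x, ⟨u, v, hu, hv, h1, hx⟩, rfl⟩
    have hb : ∀ i, -a ≤ x i ∧ x i ≤ a := hS x ⟨u, v, hu, hv, h1, hx⟩
    let s : D → ℝ := fun i => if 0 ≤ x i then 1 else -1
    let p : D → ℝ := fun i => 2 / a * max 0 (x i) - 1
    let q : D → ℝ := fun i => 2 / a * max 0 (-x i) - 1
    have hpos : 0 < 2 / a := by positivity
    have h2a : 2 / a * a = 2 := by field_simp
    have hp : ∀ i, -1 ≤ p i ∧ p i ≤ s i := by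
      intro i
      have := mul_le_mul_of_nonneg_left (hb i).2 hpos.le
      by_cases h0 : 0 ≤ x i
      · have := mul_nonneg hpos.le h0
        simp only [p, s, h0, if_true, max_eq_right]
        constructor <;> linarith
      · simp only [p, s, h0, if_false, max_eq_left (not_le.1 h0).le]
        constructor <;> linarith
    have hq : ∀ i, -1 ≤ q i ∧ q i ≤ - s i := by
      intro i
      have := mul_le_mul_of_nonneg_left (hb i).1 hpos.le
      by_cases h0 : 0 ≤ x i
      · simp only [q, s, h0, if_true, max_eq_left (neg_nonpos.2 h0)]
        constructor <;> linarith
      · have h0n : 0 ≤ -x i := by linarith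
        have := mul_nonneg hpos.le h0n
        simp only [q, s, h0, if_false, max_eq_right h0n]
        constructor <;> linarith
    have hs : ∀ i, s i = 1 ∨ s i = -1 := by
      intro i
      by_cases h0 : 0 ≤ x i <;> simp [s, h0]
    refine ⟨Sum.elim u (Sum.elim p (Sum.elim q (Sum.elim (fun i => s i - 1 - p i)
      (fun i => - s i - 1 - q i)))), Sum.elim v s, ?_, ?_, ?_, ?_⟩
    · rintro (i | i | i | i | i)
      · exact hu i
      all_goals
        have h1 := hp i
        have h2 := hq i
        simp only [Sum.elim_inl, Sum.elim_inr, abs_le]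
        rcases hs i with h | h <;> constructor <;> linarith
    · rintro (i | i)
      · exact hv i
      · exact hs i
    · ext (i | i | i | i)
      · exact congrFun h1 i
      · simp
        ring
      · simp
        ring
      · have hxi := congrFun hx i
        have hm : a / 2 * p i - a / 2 * q i = x i := by
          simp only [p, q]
          rcases le_total 0 (x i) with h0 | h0
          · rw [max_eq_right h0, max_eq_left (neg_nonpos.2 h0)]
            field_simp
            ring
          · rw [max_eq_left h0, max_eq_right (neg_nonneg.2 h0)]
            field_simp
            ring
        simp only [Pi.add_apply] at hxi
        simp
        linarith
    · ext i
      simp [p]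
      field_simp
      ring
  · rintro ⟨ξ, η, hξ, hη, h1, rfl⟩
    refine ⟨Gc.mulVec (ξ ∘ Sum.inl) + Gb.mulVec (η ∘ Sum.inl) + c,
      ⟨ξ ∘ Sum.inl, η ∘ Sum.inl, fun i => hξ _, fun i => hη _, ?_, rfl⟩, ?_⟩
    · ext i
      exact congrFun h1 (Sum.inl i)
    · ext i
      have k1 := congrFun h1 (Sum.inr (Sum.inl i))
      have k2 := congrFun h1 (Sum.inr (Sum.inr (Sum.inl i)))
      have k3 := congrFun h1 (Sum.inr (Sum.inr (Sum.inr i)))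
      have b1 := abs_le.1 (hξ (Sum.inr (Sum.inl i)))
      have b2 := abs_le.1 (hξ (Sum.inr (Sum.inr (Sum.inl i))))
      have b3 := abs_le.1 (hξ (Sum.inr (Sum.inr (Sum.inr (Sum.inl i)))))
      have b4 := abs_le.1 (hξ (Sum.inr (Sum.inr (Sum.inr (Sum.inr i)))))
      simp at k1 k2 k3
      simp
      rcases hη (Sum.inr i) with h | h
      · have e : ξ (Sum.inr (Sum.inr (Sum.inl i))) = -1 := by linarith
        rw [e] at k3
        have := mul_nonneg ha.le (by linarith [b1.1] : 0 ≤ ξ (Sum.inr (Sum.inl i)) + 1)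
        rw [max_eq_right] <;> linarith
      · have e : ξ (Sum.inr (Sum.inl i)) = -1 := by linarith
        rw [e] at k3 ⊢
        have := mul_nonneg ha.le
          (by linarith [b2.1] : 0 ≤ ξ (Sum.inr (Sum.inr (Sum.inl i))) + 1)
        rw [max_eq_left] <;> linarith

/-- Corollary 1: If `X ⊆ [-a,a]^n` is a hybrid zonotope with `n_{g,x}`
continuous generators, `n_{b,x}` binary generators, and `n_{c,x}` constraints, and
`f : ℝ^n → ℝ^m` is a feed-forward fully connected ReLU network with `n_N` total ReLU
neurons whose pre-activations lie in `[-a,a]` on inputs from `[-a,a]^n`, then the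
image set `Y = { f(x) : x ∈ X }` is a hybrid zonotope with `n_{g,x} + 4 n_N`
continuous generators, `n_{b,x} + n_N` binary generators, and `n + n_{c,x} + 3 n_N`
constraints. -/
theorem nn_image_eq_hybZono (L : ℕ) (dims : ℕ → ℕ)
    (W : ∀ ℓ, Matrix (Fin (dims (ℓ + 1))) (Fin (dims ℓ)) ℝ)
    (bv : ∀ ℓ, Fin (dims (ℓ + 1)) → ℝ)
    (a : ℝ) (ha : 0 < a)
    (hpre : ∀ x : Fin (dims 0) → ℝ, (∀ i, -a ≤ x i ∧ x i ≤ a) →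
      ∀ ℓ < L, ∀ i, -a ≤ (W ℓ).mulVec (nnLayer dims W bv x ℓ) i + bv ℓ i ∧
        (W ℓ).mulVec (nnLayer dims W bv x ℓ) i + bv ℓ i ≤ a)
    (nN : ℕ) (hnN : nN = ∑ ℓ ∈ Finset.range L, dims (ℓ + 1))
    (X : Set (Fin (dims 0) → ℝ))
    (hXbox : ∀ x ∈ X, ∀ i, -a ≤ x i ∧ x i ≤ a)
    (ngx nbx ncx : ℕ)
    (Gxc : Matrix (Fin (dims 0)) (Fin ngx) ℝ) (Gxb : Matrix (Fin (dims 0)) (Fin nbx) ℝ)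
    (cx : Fin (dims 0) → ℝ)
    (Axc : Matrix (Fin ncx) (Fin ngx) ℝ) (Axb : Matrix (Fin ncx) (Fin nbx) ℝ)
    (bx : Fin ncx → ℝ)
    (hX : X = hybZono Gxc Gxb cx Axc Axb bx) :
    ∃ (Gyc : Matrix (Fin (dims (L + 1))) (Fin (ngx + 4 * nN)) ℝ)
      (Gyb : Matrix (Fin (dims (L + 1))) (Fin (nbx + nN)) ℝ)
      (cy : Fin (dims (L + 1)) → ℝ)
      (Ayc : Matrix (Fin (dims 0 + ncx + 3 * nN)) (Fin (ngx + 4 * nN)) ℝ)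
      (Ayb : Matrix (Fin (dims 0 + ncx + 3 * nN)) (Fin (nbx + nN)) ℝ)
      (by_ : Fin (dims 0 + ncx + 3 * nN) → ℝ),
    { y : Fin (dims (L + 1)) → ℝ | ∃ x ∈ X, y = nnFun L dims W bv x } =
    hybZono Gyc Gyb cy Ayc Ayb by_ := by
  subst hnN
  have key : ∀ ℓ ≤ L, IsHZ ((fun x => nnLayer dims W bv x ℓ) '' X)
      (ngx + 4 * ∑ j ∈ Finset.range ℓ, dims (j + 1))
      (nbx + ∑ j ∈ Finset.range ℓ, dims (j + 1))
      (ncx + 3 * ∑ j ∈ Finset.range ℓ, dims (j + 1)) := by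
    intro ℓ
    induction ℓ with
    | zero =>
      intro _
      have : (fun x => nnLayer dims W bv x 0) '' X = X := by simp [nnLayer]
      rw [this]
      exact ⟨Gxc, Gxb, cx, Axc, Axb, bx, hX⟩
    | succ ℓ ih =>
      intro hℓ
      have h2 := ((ih (by omega)).affine (W ℓ) (bv ℓ)).relu a ha (by
        rintro _ ⟨_, ⟨x, hx, rfl⟩, rfl⟩ i
        exact hpre x (hXbox x hx) ℓ (by omega) i)
      rw [Set.image_image, Set.image_image] at h2
      rw [Finset.sum_range_succ]
      simp only [mul_add, ← add_assoc]
      exact h2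
  have h := ((key L le_rfl).affine (W L) (bv L)).pad (dims 0)
  rw [Set.image_image, ← add_assoc] at h
  obtain ⟨Gc, Gb, c, Ac, Ab, bb, he⟩ := h
  refine ⟨Gc, Gb, c, Ac, Ab, bb, ?_⟩
  rw [← he]
  ext y
  simp only [Set.mem_ofPred_eq, Set.mem_image, nnFun, eq_comm]
end

section
/- (Corollary 2) Consider the closed-loop system x_{k+1} = A x_k + B f(x_k), where A ∈ ℝ^{n×n}, B ∈ ℝ^{n×m}, and f : ℝ^n → ℝ^m is a feed-forward fully connected ReLU neural network with n_N ReLU neurons, with a > 0 chosen so that all pre-activations lie in [-a, a]^{n_{ℓ+1}} for inputs in [-a, a]^n. Let the initial set R_0 ⊆ [-a, a]^n be a hybrid zonotope with n_{g,0} continuous generators, n_{b,0} binary generators, and n_{c,0} constraints, and define the forward reachable sets recursively by R_{κ+1} = { A x + B f(x) : x ∈ R_κ }. If R_κ ⊆ [-a, a]^n for all κ < k, then R_k is a hybrid zonotope whose representation complexity grows linearly in k: it can be represented with n_{g,k} = n_{g,0} + 4 k n_N continuous generators, n_{b,k} = n_{b,0} + k n_N binary generators, and n_{c,k} = n_{c,0}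 + k (n + 3 n_N) constraints. -/
/-- Hybrid zonotope representability, phrased with linear maps. -/
def HZRep {ι : Type} (ng nb nc : ℕ) (S : Set (ι → ℝ)) : Prop :=
  ∃ (G : ((Fin ng → ℝ) × (Fin nb → ℝ)) →ₗ[ℝ] (ι → ℝ)) (c : ι → ℝ)
    (C : ((Fin ng → ℝ) × (Fin nb → ℝ)) →ₗ[ℝ] (Fin nc → ℝ)) (b : Fin nc → ℝ),
    ∀ z, z ∈ S ↔ ∃ (ξ : Fin ng → ℝ) (η : Fin nb → ℝ), (∀ i, |ξ i| ≤ 1) ∧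
      (∀ i, η i = 1 ∨ η i = -1) ∧ C (ξ, η) = b ∧ z = G (ξ, η) + c

theorem HZRep.congr {ι : Type} {ng nb nc ng' nb' nc' : ℕ} {S S' : Set (ι → ℝ)}
    (h : HZRep ng nb nc S) (e1 : ng' = ng) (e2 : nb' = nb) (e3 : nc' = nc) (e : S' = S) :
    HZRep ng' nb' nc' S' := by
  subst e1 e2 e3 e
  exact h

theorem HZRep.of_hyb {ι : Type} {ng nb nc : ℕ}
    (Gc : Matrix ι (Fin ng) ℝ) (Gb : Matrix ι (Fin nb) ℝ) (c : ι → ℝ)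
    (Ac : Matrix (Fin nc) (Fin ng) ℝ) (Ab : Matrix (Fin nc) (Fin nb) ℝ) (b : Fin nc → ℝ) :
    HZRep ng nb nc (hybZono Gc Gb c Ac Ab b) :=
  ⟨Gc.mulVecLin.coprod Gb.mulVecLin, c, Ac.mulVecLin.coprod Ab.mulVecLin, b, by
    intro z
    simp [hybZono]⟩

theorem HZRep.to_hyb {ι : Type} {ng nb nc : ℕ} {S : Set (ι → ℝ)} (h : HZRep ng nb nc S) :
    ∃ (Gc : Matrix ι (Fin ng) ℝ) (Gb : Matrix ι (Fin nb) ℝ) (c : ι → ℝ)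
    (Ac : Matrix (Fin nc) (Fin ng) ℝ) (Ab : Matrix (Fin nc) (Fin nb) ℝ) (b : Fin nc → ℝ),
    S = hybZono Gc Gb c Ac Ab b := by
  obtain ⟨G, c, C, b, h⟩ := h
  refine ⟨LinearMap.toMatrix' (G ∘ₗ LinearMap.inl ℝ _ _),
    LinearMap.toMatrix' (G ∘ₗ LinearMap.inr ℝ _ _), c,
    LinearMap.toMatrix' (C ∘ₗ LinearMap.inl ℝ _ _),
    LinearMap.toMatrix' (C ∘ₗ LinearMap.inr ℝ _ _), b, ?_⟩
  ext z
  rw [h]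
  simp only [hybZono, LinearMap.toMatrix'_mulVec, Set.mem_ofPred_eq, LinearMap.comp_apply,
    LinearMap.inl_apply, LinearMap.inr_apply, ← map_add, Prod.mk_add_mk, add_zero, zero_add]

theorem HZRep.affine {ι ι' : Type} {ng nb nc : ℕ} {S : Set (ι → ℝ)} (h : HZRep ng nb nc S)
    (F : (ι → ℝ) →ₗ[ℝ] (ι' → ℝ)) (d : ι' → ℝ) :
    HZRep ng nb nc ((fun x => F x + d) '' S) := by
  obtain ⟨G, c, C, b, h⟩ := h
  refine ⟨F ∘ₗ G, F c + d, C, b, fun z => ?_⟩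
  constructor
  · rintro ⟨x, hx, rfl⟩
    obtain ⟨ξ, η, h1, h2, h3, rfl⟩ := (h x).1 hx
    exact ⟨ξ, η, h1, h2, h3, by simp [add_assoc]⟩
  · rintro ⟨ξ, η, h1, h2, h3, rfl⟩
    exact ⟨_, (h _).2 ⟨ξ, η, h1, h2, h3, rfl⟩, by simp [add_assoc]⟩

theorem HZRep.pad {ι : Type} {ng nb nc : ℕ} {S : Set (ι → ℝ)} (h : HZRep ng nb nc S) (m : ℕ) :
    HZRep ng nb (nc + m) S := by
  obtain ⟨G, c, C, b, h⟩ := h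
  refine ⟨G, c, LinearMap.pi (fun i => Fin.addCases (fun j => LinearMap.proj j ∘ₗ C)
    (fun _ => 0) i), Fin.append b 0, fun z => ?_⟩
  rw [h]
  refine exists_congr fun ξ => exists_congr fun η => and_congr_right fun _ =>
    and_congr_right fun _ => and_congr_left fun _ => ?_
  constructor
  · intro e
    ext i
    refine Fin.addCases (fun j => ?_) (fun j => ?_) i
    · simp [← e]
    · simp
  · intro e
    ext j
    have := congrFun e (Fin.castAdd m j)
    simpa using this

/-- The scalar ReLU encoding. -/
theorem relu_sound {a v s p q r t : ℝ} (ha : 0 < a) (hs : s = 1 ∨ s = -1)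
    (hp : |p| ≤ 1) (hq : |q| ≤ 1) (hr : |r| ≤ 1) (ht : |t| ≤ 1)
    (e1 : a / 2 * p - v - a / 2 * q = 0) (e2 : p + r - s = -1) (e3 : q + t + s = -1) :
    a / 2 * p + a / 2 = max 0 v := by
  rw [abs_le] at *
  have ha2 : 0 < a / 2 := by linarith
  rcases hs with rfl | rfl
  · have : q = -1 := by linarith
    subst this
    rw [max_eq_right] <;> nlinarith
  · have : p = -1 := by linarith
    subst this
    rw [max_eq_left] <;> nlinarith

theorem relu_complete {a v : ℝ} (ha : 0 < a) (h1 : -a ≤ v) (h2 : v ≤ a) :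
    ∃ s p q r t : ℝ, (s = 1 ∨ s = -1) ∧ |p| ≤ 1 ∧ |q| ≤ 1 ∧ |r| ≤ 1 ∧ |t| ≤ 1 ∧
    a / 2 * p - v - a / 2 * q = 0 ∧ p + r - s = -1 ∧ q + t + s = -1 := by
  have u1 : v / a ≤ 1 := by rw [div_le_one ha]; exact h2
  have u2 : -1 ≤ v / a := by rw [le_div_iff₀ ha]; linarith
  rcases le_total 0 v with hv | hv
  · have u3 : 0 ≤ v / a := by positivity
    refine ⟨1, 2 * (v / a) - 1, -1, 1 - 2 * (v / a), -1, Or.inl rfl, ?_, ?_, ?_, ?_, ?_, ?_, ?_⟩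
    · rw [abs_le]; constructor <;> linarith
    · simp
    · rw [abs_le]; constructor <;> linarith
    · simp
    · field_simp; ring
    · ring
    · ring
  · have u3 : v / a ≤ 0 := div_nonpos_of_nonpos_of_nonneg hv ha.le
    refine ⟨-1, -1, -2 * (v / a) - 1, -1, 2 * (v / a) + 1, Or.inr rfl, ?_, ?_, ?_, ?_, ?_, ?_, ?_⟩
    · simp
    · rw [abs_le]; constructor <;> linarith
    · simp
    · rw [abs_le]; constructor <;> linarith
    · field_simp; ring
    · ring
    · ring

theorem HZRep.neuron {ι : Type} {ng nb nc : ℕ} {S : Set (ι → ℝ)} (h : HZRep ng nb nc S)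
    {a : ℝ} (ha : 0 < a) (w : (ι → ℝ) →ₗ[ℝ] ℝ) (β : ℝ)
    (hS : ∀ x ∈ S, -a ≤ w x + β ∧ w x + β ≤ a) :
    HZRep (ng + 4) (nb + 1) (nc + 3)
      ((fun x => Sum.elim x (fun _ : Unit => max 0 (w x + β))) '' S) := by
  obtain ⟨G, c, C, b, h⟩ := h
  let P : ((Fin (ng + 4) → ℝ) × (Fin (nb + 1) → ℝ)) →ₗ[ℝ] ((Fin ng → ℝ) × (Fin nb → ℝ)) :=
    (LinearMap.funLeft ℝ ℝ (Fin.castAdd 4)).prodMap (LinearMap.funLeft ℝ ℝ (Fin.castAdd 1))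
  let Q : Fin 4 → ((Fin (ng + 4) → ℝ) × (Fin (nb + 1) → ℝ)) →ₗ[ℝ] ℝ := fun j =>
    LinearMap.proj (Fin.natAdd ng j) ∘ₗ LinearMap.fst ℝ _ _
  let T : ((Fin (ng + 4) → ℝ) × (Fin (nb + 1) → ℝ)) →ₗ[ℝ] ℝ :=
    LinearMap.proj (Fin.natAdd nb 0) ∘ₗ LinearMap.snd ℝ _ _
  let K : Fin 3 → ((Fin (ng + 4) → ℝ) × (Fin (nb + 1) → ℝ)) →ₗ[ℝ] ℝ :=
    ![(a / 2) • Q 0 - w ∘ₗ G ∘ₗ P - (a / 2) • Q 1, Q 0 + Q 2 - T, Q 1 + Q 3 + T]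
  refine ⟨LinearMap.pi (Sum.elim (fun i => LinearMap.proj i ∘ₗ G ∘ₗ P)
      (fun _ => (a / 2) • Q 0)), Sum.elim c (fun _ => a / 2),
    LinearMap.pi (fun i => Fin.addCases (fun j => LinearMap.proj j ∘ₗ C ∘ₗ P) K i),
    Fin.append b ![w c + β, -1, -1], fun z => ?_⟩
  constructor
  · rintro ⟨x, hx, rfl⟩
    obtain ⟨b1, b2⟩ := hS x hx
    obtain ⟨ξ, η, h1, h2, h3, rfl⟩ := (h x).1 hx
    obtain ⟨s, p, q, r, t, hs, hp, hq, hr, ht, e1, e2, e3⟩ := relu_complete ha b1 b2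
    have hy := relu_sound ha hs hp hq hr ht e1 e2 e3
    have hP : P (Fin.append ξ ![p, q, r, t], Fin.append η ![s]) = (ξ, η) := by
      ext i <;> simp [P, LinearMap.funLeft_apply]
    refine ⟨Fin.append ξ ![p, q, r, t], Fin.append η ![s], ?_, ?_, ?_, ?_⟩
    · intro i
      refine Fin.addCases (fun j => ?_) (fun j => ?_) i
      · simpa using h1 j
      · rw [Fin.append_right]
        fin_cases j <;> simpa
    · intro i
      refine Fin.addCases (fun j => ?_) (fun j => ?_) i
      · simpa using h2 j
      · rw [Fin.append_right]
        fin_cases j; simpa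
    · ext i
      refine Fin.addCases (fun j => ?_) (fun j => ?_) i
      · simp only [LinearMap.pi_apply, Fin.addCases_left, LinearMap.comp_apply, hP, h3,
          Fin.append_left, LinearMap.proj_apply]
      · simp only [LinearMap.pi_apply, Fin.addCases_right, Fin.append_right]
        rw [map_add] at e1
        fin_cases j
        · simp [K, hP, Q]
          linarith
        · simpa [K, Q, T] using e2
        · simpa [K, Q, T] using e3
    · ext i
      rcases i with i | i
      · simp [hP]
      · simp [Q, hy]
  · rintro ⟨ξ, η, h1, h2, h3, rfl⟩
    have k0 := congrFun h3 (Fin.natAdd nc 0)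
    have k1 := congrFun h3 (Fin.natAdd nc 1)
    have k2 := congrFun h3 (Fin.natAdd nc 2)
    simp only [LinearMap.pi_apply, Fin.addCases_right, Fin.append_right] at k0 k1 k2
    simp [K, Q, T] at k0 k1 k2
    refine ⟨G (P (ξ, η)) + c, (h _).2 ⟨_, _, fun i => h1 (Fin.castAdd 4 i),
      fun i => h2 (Fin.castAdd 1 i), ?_, rfl⟩, ?_⟩
    · ext j
      have := congrFun h3 (Fin.castAdd 3 j)
      simp only [LinearMap.pi_apply, Fin.addCases_left, Fin.append_left] at this
      exact this
    · have hy := relu_sound (v := w (G (P (ξ, η)) + c) + β) ha (h2 (Fin.natAdd nb 0))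
        (h1 (Fin.natAdd ng 0)) (h1 (Fin.natAdd ng 1)) (h1 (Fin.natAdd ng 2))
        (h1 (Fin.natAdd ng 3)) (by rw [map_add]; linarith) (by simpa using k1) (by simpa using k2)
      ext i
      rcases i with i | i
      · simp
      · simp [Q, hy]

theorem HZRep.layer {ι : Type} {ng nb nc : ℕ} {S : Set (ι → ℝ)} (h : HZRep ng nb nc S)
    {a : ℝ} (ha : 0 < a) (d : ℕ) (w : Fin d → (ι → ℝ) →ₗ[ℝ] ℝ) (β : Fin d → ℝ)
    (hS : ∀ x ∈ S, ∀ i, -a ≤ w i x + β i ∧ w i x + β i ≤ a) :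
    HZRep (ng + 4 * d) (nb + d) (nc + 3 * d)
      ((fun x => Sum.elim x (fun i : Fin d => max 0 (w i x + β i))) '' S) := by
  induction d with
  | zero =>
    have := h.affine (LinearMap.pi (Sum.elim (fun i => LinearMap.proj i) (fun i : Fin 0 => 0))) 0
    refine this.congr (by simp) (by simp) (by simp) (Set.image_congr fun x hx => ?_)
    ext i
    rcases i with i | i
    · simp
    · exact i.elim0
  | succ d ih =>
    have h1 := ih (fun i => w i.castSucc) (fun i => β i.castSucc) (fun x hx i => hS x hx _)
    have h2 := h1.neuron ha (w (Fin.last d) ∘ₗ LinearMap.funLeft ℝ ℝ Sum.inl) (β (Fin.last d))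
      (by
        rintro _ ⟨x, hx, rfl⟩
        exact hS x hx _)
    have h3 := h2.affine (LinearMap.funLeft ℝ ℝ (Sum.elim (fun i => Sum.inl (Sum.inl i))
      (Fin.lastCases (Sum.inr ()) (fun j => Sum.inl (Sum.inr j))) :
        ι ⊕ Fin (d + 1) → (ι ⊕ Fin d) ⊕ Unit)) 0
    refine h3.congr (by ring) (by ring) (by ring) ?_
    · rw [Set.image_image, Set.image_image]
      refine Set.image_congr fun x hx => ?_
      ext i
      rcases i with i | i
      · simp [LinearMap.funLeft_apply]
      · refine Fin.lastCases ?_ (fun j => ?_) i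
        · simp [LinearMap.funLeft_apply]
          rfl
        · simp [LinearMap.funLeft_apply]

theorem HZRep.net {dims : ℕ → ℕ}
    {W : ∀ ℓ, Matrix (Fin (dims (ℓ + 1))) (Fin (dims ℓ)) ℝ}
    {bv : ∀ ℓ, Fin (dims (ℓ + 1)) → ℝ}
    {ng nb nc : ℕ} {S : Set (Fin (dims 0) → ℝ)} (h : HZRep ng nb nc S)
    {a : ℝ} (ha : 0 < a) (L : ℕ)
    (hS : ∀ x ∈ S, ∀ ℓ < L, ∀ i, -a ≤ (W ℓ).mulVec (nnLayer dims W bv x ℓ) i + bv ℓ i ∧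
        (W ℓ).mulVec (nnLayer dims W bv x ℓ) i + bv ℓ i ≤ a) :
    HZRep (ng + 4 * ∑ ℓ ∈ Finset.range L, dims (ℓ + 1))
      (nb + ∑ ℓ ∈ Finset.range L, dims (ℓ + 1)) (nc + 3 * ∑ ℓ ∈ Finset.range L, dims (ℓ + 1))
      ((fun x => Sum.elim x (nnLayer dims W bv x L)) '' S) := by
  induction L with
  | zero =>
    have := h.affine (LinearMap.funLeft ℝ ℝ
      (Sum.elim id id : Fin (dims 0) ⊕ Fin (dims 0) → Fin (dims 0))) 0
    refine this.congr (by simp) (by simp) (by simp) (Set.image_congr fun x hx => ?_)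
    ext i
    rcases i with i | i <;> simp [nnLayer, LinearMap.funLeft_apply]
  | succ L ih =>
    have h1 := ih (fun x hx ℓ hℓ => hS x hx ℓ (by omega))
    have h2 := h1.layer ha (dims (L + 1))
      (fun i => LinearMap.proj i ∘ₗ (W L).mulVecLin ∘ₗ LinearMap.funLeft ℝ ℝ Sum.inr) (bv L) (by
        rintro _ ⟨x, hx, rfl⟩ i
        exact hS x hx L (by omega) i)
    have h3 := h2.affine (LinearMap.funLeft ℝ ℝ (Sum.elim (fun i => Sum.inl (Sum.inl i)) Sum.inr :
        Fin (dims 0) ⊕ Fin (dims (L + 1)) →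
          (Fin (dims 0) ⊕ Fin (dims L)) ⊕ Fin (dims (L + 1)))) 0
    rw [Finset.sum_range_succ]
    refine h3.congr (by ring) (by ring) (by ring) ?_
    · rw [Set.image_image, Set.image_image]
      refine Set.image_congr fun x hx => ?_
      ext i
      rcases i with i | i
      · simp [LinearMap.funLeft_apply]
      · simp [LinearMap.funLeft_apply, nnLayer]
        rfl

/-- Corollary 2: For the closed-loop system `x_{k+1} = A x_k + B f(x_k)`
with `f` a feed-forward fully connected ReLU network with `n_N` ReLU neurons (and `a>0`
bounding all pre-activations on `[-a,a]^n`), if the initial set `R_0` is a hybrid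
zonotope with `n_{g,0}` continuous generators, `n_{b,0}` binary generators, and
`n_{c,0}` constraints, and the reachable sets `R_{κ+1} = { A x + B f(x) : x ∈ R_κ }`
satisfy `R_κ ⊆ [-a,a]^n` for all `κ < k`, then `R_k` is a hybrid zonotope with
`n_{g,0} + 4 k n_N` continuous generators, `n_{b,0} + k n_N` binary generators, and
`n_{c,0} + k (n + 3 n_N)` constraints.  Here `n = dims 0` and `m = dims (L+1)`. -/
theorem closed_loop_reach_linear_growth (L : ℕ) (dims : ℕ → ℕ)
    (W : ∀ ℓ, Matrix (Fin (dims (ℓ + 1))) (Fin (dims ℓ)) ℝ)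
    (bv : ∀ ℓ, Fin (dims (ℓ + 1)) → ℝ)
    (a : ℝ) (ha : 0 < a)
    (hpre : ∀ x : Fin (dims 0) → ℝ, (∀ i, -a ≤ x i ∧ x i ≤ a) →
      ∀ ℓ < L, ∀ i, -a ≤ (W ℓ).mulVec (nnLayer dims W bv x ℓ) i + bv ℓ i ∧
        (W ℓ).mulVec (nnLayer dims W bv x ℓ) i + bv ℓ i ≤ a)
    (nN : ℕ) (hnN : nN = ∑ ℓ ∈ Finset.range L, dims (ℓ + 1))
    (A : Matrix (Fin (dims 0)) (Fin (dims 0)) ℝ)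
    (B : Matrix (Fin (dims 0)) (Fin (dims (L + 1))) ℝ)
    (R : ℕ → Set (Fin (dims 0) → ℝ))
    (ng0 nb0 nc0 : ℕ)
    (G0c : Matrix (Fin (dims 0)) (Fin ng0) ℝ) (G0b : Matrix (Fin (dims 0)) (Fin nb0) ℝ)
    (c0 : Fin (dims 0) → ℝ)
    (A0c : Matrix (Fin nc0) (Fin ng0) ℝ) (A0b : Matrix (Fin nc0) (Fin nb0) ℝ)
    (b0 : Fin nc0 → ℝ)
    (hR0 : R 0 = hybZono G0c G0b c0 A0c A0b b0)
    (hrec : ∀ κ, R (κ + 1) =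
      { z | ∃ x ∈ R κ, z = A.mulVec x + B.mulVec (nnFun L dims W bv x) })
    (k : ℕ)
    (hbox : ∀ κ < k, ∀ x ∈ R κ, ∀ i, -a ≤ x i ∧ x i ≤ a) :
    ∃ (Gc : Matrix (Fin (dims 0)) (Fin (ng0 + 4 * k * nN)) ℝ)
      (Gb : Matrix (Fin (dims 0)) (Fin (nb0 + k * nN)) ℝ)
      (c : Fin (dims 0) → ℝ)
      (Ac : Matrix (Fin (nc0 + k * (dims 0 + 3 * nN))) (Fin (ng0 + 4 * k * nN)) ℝ)
      (Ab : Matrix (Fin (nc0 + k * (dims 0 + 3 * nN))) (Fin (nb0 + k * nN)) ℝ)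
      (b : Fin (nc0 + k * (dims 0 + 3 * nN)) → ℝ),
    R k = hybZono Gc Gb c Ac Ab b := by
  apply HZRep.to_hyb
  have key : ∀ κ ≤ k, HZRep (ng0 + 4 * κ * nN) (nb0 + κ * nN)
      (nc0 + κ * (dims 0 + 3 * nN)) (R κ) := by
    intro κ
    induction κ with
    | zero =>
      intro _
      rw [hR0]
      simpa using HZRep.of_hyb G0c G0b c0 A0c A0b b0
    | succ κ ih =>
      intro hκ
      have h1 := (ih (by omega)).net (W := W) (bv := bv) ha L
        (fun x hx => hpre x (hbox κ (by omega) x hx))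
      rw [← hnN] at h1
      have h2 := (h1.affine (A.mulVecLin ∘ₗ LinearMap.funLeft ℝ ℝ Sum.inl +
        B.mulVecLin ∘ₗ (W L).mulVecLin ∘ₗ LinearMap.funLeft ℝ ℝ Sum.inr)
        (B.mulVec (bv L))).pad (dims 0)
      refine h2.congr (by ring) (by ring) (by ring) ?_
      · rw [hrec, Set.image_image]
        ext z
        simp only [Set.mem_ofPred_eq, Set.mem_image]
        refine exists_congr fun x => and_congr_right fun _ => ?_
        rw [eq_comm]
        refine Eq.congr ?_ rfl
        simp only [nnFun, Matrix.mulVec_add, LinearMap.add_apply, LinearMap.comp_apply,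
          Matrix.mulVecLin_apply, add_assoc]
        rfl
  exact key k le_rfl
end

section
/- (Corollary 3) Consider the closed-loop system x_{k+1} = A x_k + B f(x_k), where A ∈ ℝ^{n×n}, B ∈ ℝ^{n×m}, and f : ℝ^n → ℝ^m is a feed-forward fully connected ReLU neural network with n_N ReLU neurons, with a > 0 chosen so that all pre-activations lie in [-a, a]^{n_{ℓ+1}} for inputs in [-a, a]^n. Let the initial set R_0 ⊆ [-a, a]^n be a hybrid zonotope with n_{g,0} continuous generators, n_{b,0} binary generators, and n_{c,0} constraints, with reachable sets R_{κ+1} = { A x + B f(x) : x ∈ R_κ } satisfying R_κ ⊆ [-a, a]^n for all κ < k. Then the aggregate trajectory set R_{0:k} = { (x_0, x_1, …, x_k) ∈ ℝ^{(k+1)n} : x_0 ∈ R_0 and x_{κ+1} = A x_κ + B f(x_κ) for κ = 0, …, k−1 } is a hybrid zonotope with n_{g,0} + 4 k n_N continuous generators, n_{b,0} + k n_N binary generators, and n_{c,0} + (n + 3 n_N)·(k(k+1)/2) constraints. -/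
/-- Affine real functionals on a finite-dimensional coordinate space. -/
def IsAff {σ : Type} [Fintype σ] (f : (σ → ℝ) → ℝ) : Prop :=
  ∃ (w : σ → ℝ) (d : ℝ), ∀ x, f x = ∑ i, w i * x i + d

theorem IsAff.const {σ : Type} [Fintype σ] (d : ℝ) : IsAff (fun _ : σ → ℝ => d) :=
  ⟨fun _ => 0, d, fun x => by simp⟩

theorem IsAff.proj {σ : Type} [Fintype σ] (i : σ) : IsAff (fun x : σ → ℝ => x i) := by
  classical
  exact ⟨fun j => if j = i then 1 else 0, 0, fun x => by simp⟩

theorem IsAff.add {σ : Type} [Fintype σ] {f g : (σ → ℝ) → ℝ} (hf : IsAff f) (hg : IsAff g) :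
    IsAff (fun x => f x + g x) := by
  obtain ⟨w, d, h⟩ := hf
  obtain ⟨w', d', h'⟩ := hg
  refine ⟨fun i => w i + w' i, d + d', fun x => ?_⟩
  simp only [h, h', add_mul, Finset.sum_add_distrib]
  ring

theorem IsAff.smul {σ : Type} [Fintype σ] {f : (σ → ℝ) → ℝ} (r : ℝ) (hf : IsAff f) :
    IsAff (fun x => r * f x) := by
  obtain ⟨w, d, h⟩ := hf
  refine ⟨fun i => r * w i, r * d, fun x => ?_⟩
  simp only [h, mul_add, Finset.mul_sum, mul_assoc]

theorem IsAff.sub {σ : Type} [Fintype σ] {f g : (σ → ℝ) → ℝ} (hf : IsAff f) (hg : IsAff g) :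
    IsAff (fun x => f x - g x) := by
  have := hf.add (hg.smul (-1))
  simpa [sub_eq_add_neg] using this

theorem IsAff.sum {σ τ : Type} [Fintype σ] (s : Finset τ) {f : τ → (σ → ℝ) → ℝ}
    (hf : ∀ t, IsAff (f t)) : IsAff (fun x => ∑ t ∈ s, f t x) := by
  classical
  induction s using Finset.induction_on with
  | empty => simpa using IsAff.const (σ := σ) 0
  | insert t s hts ih =>
    simp only [Finset.sum_insert hts]
    exact (hf t).add ih

theorem IsAff.comp {σ τ : Type} [Fintype σ] [Fintype τ] {f : (τ → ℝ) → ℝ} (hf : IsAff f)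
    {g : τ → (σ → ℝ) → ℝ} (hg : ∀ t, IsAff (g t)) : IsAff (fun x => f (fun t => g t x)) := by
  obtain ⟨w, d, h⟩ := hf
  simp only [h]
  exact (IsAff.sum _ fun t => (hg t).smul (w t)).add (IsAff.const d)

theorem IsAff.mulVec {σ m n : Type} [Fintype σ] [Fintype n] (M : Matrix m n ℝ)
    {g : n → (σ → ℝ) → ℝ} (hg : ∀ t, IsAff (g t)) (i : m) :
    IsAff (fun x => M.mulVec (fun t => g t x) i) := by
  simp only [Matrix.mulVec, dotProduct]
  exact IsAff.sum _ fun t => (hg t).smul _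

/-- `S` is a hybrid zonotope with `p` continuous generators, `q` binary generators and
`r` constraints, in functional form. -/
def HZ {ι : Type} (p q r : ℕ) (S : Set (ι → ℝ)) : Prop :=
  ∃ (γ β κ : Type) (_ : Fintype γ) (_ : Fintype β) (_ : Fintype κ),
    Fintype.card γ = p ∧ Fintype.card β = q ∧ Fintype.card κ = r ∧
    ∃ (P : ι → (γ ⊕ β → ℝ) → ℝ) (Q : κ → (γ ⊕ β → ℝ) → ℝ),
      (∀ i, IsAff (P i)) ∧ (∀ i, IsAff (Q i)) ∧
      ∀ z, z ∈ S ↔ ∃ ξ : γ ⊕ β → ℝ, (∀ i, |ξ (Sum.inl i)| ≤ 1) ∧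
        (∀ i, ξ (Sum.inr i) = 1 ∨ ξ (Sum.inr i) = -1) ∧ (∀ i, Q i ξ = 0) ∧ z = fun i => P i ξ

theorem HZ.of_hybZono {ι : Type} {p q r : ℕ}
    (Gc : Matrix ι (Fin p) ℝ) (Gb : Matrix ι (Fin q) ℝ) (c : ι → ℝ)
    (Ac : Matrix (Fin r) (Fin p) ℝ) (Ab : Matrix (Fin r) (Fin q) ℝ) (b : Fin r → ℝ) :
    HZ p q r (hybZono Gc Gb c Ac Ab b) := by
  refine ⟨Fin p, Fin q, Fin r, inferInstance, inferInstance, inferInstance, by simp, by simp,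
    by simp,
    fun i ξ => Gc.mulVec (fun t => ξ (Sum.inl t)) i + Gb.mulVec (fun t => ξ (Sum.inr t)) i + c i,
    fun i ξ => Ac.mulVec (fun t => ξ (Sum.inl t)) i + Ab.mulVec (fun t => ξ (Sum.inr t)) i - b i,
    fun i => ?_, fun i => ?_, fun z => ?_⟩
  · exact ((IsAff.mulVec _ (fun t => IsAff.proj _) i).add
      (IsAff.mulVec _ (fun t => IsAff.proj _) i)).add (IsAff.const _)
  · exact ((IsAff.mulVec _ (fun t => IsAff.proj _) i).add
      (IsAff.mulVec _ (fun t => IsAff.proj _) i)).sub (IsAff.const _)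
  · constructor
    · rintro ⟨ξc, ξb, h1, h2, h3, h4⟩
      refine ⟨Sum.elim ξc ξb, h1, h2, fun i => ?_, ?_⟩
      · have := congrFun h3 i
        simp only [Sum.elim_inl, Sum.elim_inr]
        simp only [Pi.add_apply] at this
        linarith
      · rw [h4]; rfl
    · rintro ⟨ξ, h1, h2, h3, h4⟩
      refine ⟨fun t => ξ (Sum.inl t), fun t => ξ (Sum.inr t), h1, h2, ?_, ?_⟩
      · funext i
        have := h3 i
        simp only [Pi.add_apply]
        linarith
      · rw [h4]; rfl

theorem HZ.to_hybZono {ι : Type} {p q r : ℕ} {S : Set (ι → ℝ)} (h : HZ p q r S) :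
    ∃ (Gc : Matrix ι (Fin p) ℝ) (Gb : Matrix ι (Fin q) ℝ) (c : ι → ℝ)
      (Ac : Matrix (Fin r) (Fin p) ℝ) (Ab : Matrix (Fin r) (Fin q) ℝ) (b : Fin r → ℝ),
      S = hybZono Gc Gb c Ac Ab b := by
  obtain ⟨γ, β, κ, _, _, _, hp, hq, hr, P, Q, hP, hQ, hS⟩ := h
  choose wP dP hP using hP
  choose wQ dQ hQ using hQ
  let eγ := Fintype.equivFinOfCardEq hp
  let eβ := Fintype.equivFinOfCardEq hq
  let eκ := Fintype.equivFinOfCardEq hr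
  refine ⟨fun i j => wP i (Sum.inl (eγ.symm j)), fun i j => wP i (Sum.inr (eβ.symm j)), dP,
    fun i j => wQ (eκ.symm i) (Sum.inl (eγ.symm j)),
    fun i j => wQ (eκ.symm i) (Sum.inr (eβ.symm j)), fun i => - dQ (eκ.symm i), ?_⟩
  have key : ∀ (w : γ ⊕ β → ℝ) (ξc : Fin p → ℝ) (ξb : Fin q → ℝ),
      ∑ i, w i * (Sum.elim (ξc ∘ eγ) (ξb ∘ eβ)) i =
      ∑ j, w (Sum.inl (eγ.symm j)) * ξc j + ∑ j, w (Sum.inr (eβ.symm j)) * ξb j := by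
    intro w ξc ξb
    rw [Fintype.sum_sum_type]
    congr 1
    · exact Fintype.sum_equiv eγ _ _ (fun x => by simp)
    · exact Fintype.sum_equiv eβ _ _ (fun x => by simp)
  ext z
  rw [hS]
  constructor
  · rintro ⟨ξ, h1, h2, h3, h4⟩
    have hξ : ξ = Sum.elim ((fun j => ξ (Sum.inl (eγ.symm j))) ∘ eγ)
        ((fun j => ξ (Sum.inr (eβ.symm j))) ∘ eβ) := by
      funext x; cases x <;> simp
    refine ⟨fun j => ξ (Sum.inl (eγ.symm j)), fun j => ξ (Sum.inr (eβ.symm j)),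
      fun i => h1 _, fun i => h2 _, ?_, ?_⟩
    · funext i
      have := h3 (eκ.symm i)
      rw [hQ, hξ, key] at this
      simp only [Pi.add_apply, Matrix.mulVec, dotProduct]
      linarith
    · rw [h4]
      funext i
      rw [hP, hξ, key]
      simp [Matrix.mulVec, dotProduct]
  · rintro ⟨ξc, ξb, h1, h2, h3, h4⟩
    refine ⟨Sum.elim (ξc ∘ eγ) (ξb ∘ eβ), fun i => h1 _, fun i => h2 _, fun i => ?_, ?_⟩
    · have := congrFun h3 (eκ i)
      simp only [Pi.add_apply, Matrix.mulVec, dotProduct, Equiv.symm_apply_apply] at this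
      rw [hQ, key]
      linarith
    · rw [h4]
      funext i
      rw [hP, key]
      simp [Matrix.mulVec, dotProduct]

theorem HZ.pad {ι : Type} {p q r r' : ℕ} {S : Set (ι → ℝ)} (h : HZ p q r S) (hr' : r ≤ r') :
    HZ p q r' S := by
  obtain ⟨γ, β, κ, _, _, _, hp, hq, hr, P, Q, hP, hQ, hS⟩ := h
  refine ⟨γ, β, κ ⊕ Fin (r' - r), inferInstance, inferInstance, inferInstance, hp, hq,
    by simp [hr]; omega, P, Sum.elim Q (fun _ _ => 0), hP, ?_, ?_⟩
  · rintro (i | i)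
    · exact hQ i
    · exact IsAff.const 0
  · intro z
    rw [hS]
    simp

theorem HZ.map {ι ι' T : Type} [Fintype ι] {p q r : ℕ} {X : Set T} {g : T → ι → ℝ}
    (h : HZ p q r (g '' X)) {F : ι' → (ι → ℝ) → ℝ} (hF : ∀ i, IsAff (F i))
    {g' : T → ι' → ℝ} (hg' : ∀ t ∈ X, ∀ i, g' t i = F i (g t)) : HZ p q r (g' '' X) := by
  obtain ⟨γ, β, κ, _, _, _, hp, hq, hr, P, Q, hP, hQ, hS⟩ := h
  refine ⟨γ, β, κ, inferInstance, inferInstance, inferInstance, hp, hq, hr,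
    fun i ξ => F i (fun j => P j ξ), Q, fun i => (hF i).comp hP, hQ, fun z => ?_⟩
  constructor
  · rintro ⟨t, ht, rfl⟩
    obtain ⟨ξ, h1, h2, h3, h4⟩ := (hS (g t)).1 ⟨t, ht, rfl⟩
    refine ⟨ξ, h1, h2, h3, ?_⟩
    funext i
    rw [hg' t ht, h4]
  · rintro ⟨ξ, h1, h2, h3, rfl⟩
    obtain ⟨t, ht, h4⟩ := (hS _).2 ⟨ξ, h1, h2, h3, rfl⟩
    refine ⟨t, ht, ?_⟩
    funext i
    rw [hg' t ht, h4]

theorem HZ.relu {ι μ T : Type} [Fintype ι] [Fintype μ] {p q r : ℕ} {X : Set T} {g : T → ι → ℝ}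
    (h : HZ p q r (g '' X)) {V : μ → (ι → ℝ) → ℝ} (hV : ∀ i, IsAff (V i))
    {a : ℝ} (ha : 0 < a) (hb : ∀ t ∈ X, ∀ i, -a ≤ V i (g t) ∧ V i (g t) ≤ a) :
    HZ (p + 4 * Fintype.card μ) (q + Fintype.card μ) (r + 3 * Fintype.card μ)
      ((fun t => Sum.elim (g t) (fun i => max 0 (V i (g t)))) '' X) := by
  obtain ⟨γ, β, κ, _, _, _, hp, hq, hr, P, Q, hP, hQ, hS⟩ := h
  let old : ((γ ⊕ (Fin 4 × μ)) ⊕ (β ⊕ μ) → ℝ) → (γ ⊕ β → ℝ) :=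
    fun ξ t => ξ (Sum.map Sum.inl Sum.inl t)
  let y : Fin 4 → μ → ((γ ⊕ (Fin 4 × μ)) ⊕ (β ⊕ μ) → ℝ) → ℝ :=
    fun k i ξ => a / 2 * ξ (Sum.inl (Sum.inr (k, i))) + a / 2
  let s : μ → ((γ ⊕ (Fin 4 × μ)) ⊕ (β ⊕ μ) → ℝ) → ℝ := fun i ξ => ξ (Sum.inr (Sum.inr i))
  let v : μ → ((γ ⊕ (Fin 4 × μ)) ⊕ (β ⊕ μ) → ℝ) → ℝ := fun i ξ => V i (fun j => P j (old ξ))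
  have hy : ∀ k i, IsAff (y k i) := fun k i => ((IsAff.proj _).smul _).add (IsAff.const _)
  have hs : ∀ i, IsAff (s i) := fun i => IsAff.proj _
  have hP' : ∀ i, IsAff (fun ξ => P i (old ξ)) := fun i => (hP i).comp fun t => IsAff.proj _
  have hQ' : ∀ i, IsAff (fun ξ => Q i (old ξ)) := fun i => (hQ i).comp fun t => IsAff.proj _
  have hv : ∀ i, IsAff (v i) := fun i => (hV i).comp hP'
  refine ⟨γ ⊕ (Fin 4 × μ), β ⊕ μ, κ ⊕ (μ ⊕ (μ ⊕ μ)), inferInstance, inferInstance, inferInstance,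
    by simp [hp], by simp [hq], by simp [hr]; ring,
    Sum.elim (fun i ξ => P i (old ξ)) (y 0),
    Sum.elim (fun i ξ => Q i (old ξ))
      (Sum.elim (fun i ξ => y 0 i ξ - v i ξ - y 1 i ξ)
        (Sum.elim (fun i ξ => y 0 i ξ + y 2 i ξ - (a / 2 * s i ξ + a / 2))
          (fun i ξ => y 1 i ξ + y 3 i ξ - (a / 2 - a / 2 * s i ξ)))), ?_, ?_, fun z => ?_⟩
  · rintro (i | i)
    · exact hP' i
    · exact hy 0 i
  · rintro (i | i | i | i)
    · exact hQ' i
    · exact ((hy 0 i).sub (hv i)).sub (hy 1 i)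
    · exact ((hy 0 i).add (hy 2 i)).sub (((hs i).smul _).add (IsAff.const _))
    · exact ((hy 1 i).add (hy 3 i)).sub ((IsAff.const _).sub ((hs i).smul _))
  · constructor
    · rintro ⟨t, ht, rfl⟩
      obtain ⟨ξ, h1, h2, h3, h4⟩ := (hS (g t)).1 ⟨t, ht, rfl⟩
      let u : μ → ℝ := fun i => V i (g t)
      let sg : μ → ℝ := fun i => if 0 ≤ u i then 1 else -1
      let Y : Fin 4 → μ → ℝ := fun k i =>
        ![max 0 (u i), max 0 (u i) - u i, (a / 2 * sg i + a / 2) - max 0 (u i),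
          (a / 2 - a / 2 * sg i) - (max 0 (u i) - u i)] k
      have hY : ∀ k i, 0 ≤ Y k i ∧ Y k i ≤ a := by
        intro k i
        have := hb t ht i
        change -a ≤ u i ∧ u i ≤ a at this
        obtain ⟨hl, hu⟩ := this
        by_cases h0 : 0 ≤ u i
        · fin_cases k <;> simp [Y, sg, h0] <;> (try constructor) <;> linarith
        · have h0' : u i ≤ 0 := by linarith
          fin_cases k <;> simp [Y, sg, h0, h0'] <;> (try constructor) <;> linarith
      let ξ' : (γ ⊕ (Fin 4 × μ)) ⊕ (β ⊕ μ) → ℝ :=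
        Sum.elim (Sum.elim (fun i => ξ (Sum.inl i)) (fun ki => (2 * Y ki.1 ki.2 - a) / a))
          (Sum.elim (fun i => ξ (Sum.inr i)) sg)
      have hold : old ξ' = ξ := by
        funext x; cases x <;> rfl
      have hyY : ∀ k i, y k i ξ' = Y k i := by
        intro k i
        simp only [y, ξ', Sum.elim_inl, Sum.elim_inr]
        field_simp
        ring
      have hvu : ∀ i, v i ξ' = u i := by
        intro i
        simp only [v, hold, u, h4]
      have hss : ∀ i, s i ξ' = sg i := fun i => rfl
      refine ⟨ξ', ?_, ?_, ?_, ?_⟩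
      · rintro (i | ⟨k, i⟩)
        · exact h1 i
        · have := hY k i
          simp only [ξ', Sum.elim_inl, Sum.elim_inr]
          rw [abs_le, le_div_iff₀ ha, div_le_iff₀ ha]
          constructor <;> linarith
      · rintro (i | i)
        · exact h2 i
        · simp only [ξ', Sum.elim_inr, sg]
          split_ifs <;> simp
      · rintro (i | i | i | i)
        · simp only [Sum.elim_inl, hold]; exact h3 i
        · simp only [Sum.elim_inl, Sum.elim_inr, hyY, hvu]
          simp [Y]
        · simp only [Sum.elim_inl, Sum.elim_inr, hyY, hss]
          simp [Y]
        · simp only [Sum.elim_inr, hyY, hss]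
          simp [Y]
      · funext x
        rcases x with i | i
        · simp only [Sum.elim_inl, hold, h4]
        · simp only [Sum.elim_inr, hyY]
          simp [Y, u]
    · rintro ⟨ξ', h1, h2, h3, rfl⟩
      obtain ⟨t, ht, h4⟩ := (hS (fun i => P i (old ξ'))).2
        ⟨old ξ', fun i => h1 (Sum.inl i), fun i => h2 (Sum.inl i), fun i => h3 (Sum.inl i), rfl⟩
      refine ⟨t, ht, ?_⟩
      funext x
      rcases x with i | i
      · simp only [Sum.elim_inl, h4]
      · simp only [Sum.elim_inr, h4]
        change max 0 (v i ξ') = y 0 i ξ'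
        have e1 := h3 (Sum.inr (Sum.inl i))
        have e2 := h3 (Sum.inr (Sum.inr (Sum.inl i)))
        have e3 := h3 (Sum.inr (Sum.inr (Sum.inr i)))
        simp only [Sum.elim_inl, Sum.elim_inr] at e1 e2 e3
        have hn : ∀ k, 0 ≤ y k i ξ' := by
          intro k
          have := (abs_le.1 (h1 (Sum.inr (k, i)))).1
          simp only [y]
          nlinarith
        have n0 := hn 0
        have n1 := hn 1
        have n2 := hn 2
        have n3 := hn 3
        rcases h2 (Sum.inr i) with hs1 | hs1
        · have hs1 : s i ξ' = 1 := hs1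
          rw [hs1] at e2 e3
          rw [max_eq_right] <;> linarith
        · have hs1 : s i ξ' = -1 := hs1
          rw [hs1] at e2 e3
          rw [max_eq_left] <;> linarith

/-- Corollary 3: For the closed-loop system `x_{k+1} = A x_k + B f(x_k)`
with `f` a feed-forward fully connected ReLU network with `n_N` ReLU neurons (and `a>0`
bounding all pre-activations on `[-a,a]^n`), if the initial set `R_0` is a hybrid
zonotope with `n_{g,0}` continuous generators, `n_{b,0}` binary generators and `n_{c,0}`
constraints, with the reachable sets `R_{κ+1} = { A x + B f(x) : x ∈ R_κ }` contained in
`[-a,a]^n` for all `κ < k`, then the aggregate trajectory set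
`R_{0:k} = { (x_0, …, x_k) : x_0 ∈ R_0, x_{κ+1} = A x_κ + B f(x_κ) }` (a subset of
`ℝ^{(k+1)n}`, identified with functions on `Fin (k+1) × Fin n`) is a hybrid zonotope
with `n_{g,0} + 4 k n_N` continuous generators, `n_{b,0} + k n_N` binary generators,
and `n_{c,0} + (n + 3 n_N)·(k(k+1)/2)` constraints.  Here `n = dims 0`. -/
theorem closed_loop_aggregate_reach (L : ℕ) (dims : ℕ → ℕ)
    (W : ∀ ℓ, Matrix (Fin (dims (ℓ + 1))) (Fin (dims ℓ)) ℝ)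
    (bv : ∀ ℓ, Fin (dims (ℓ + 1)) → ℝ)
    (a : ℝ) (ha : 0 < a)
    (hpre : ∀ x : Fin (dims 0) → ℝ, (∀ i, -a ≤ x i ∧ x i ≤ a) →
      ∀ ℓ < L, ∀ i, -a ≤ (W ℓ).mulVec (nnLayer dims W bv x ℓ) i + bv ℓ i ∧
        (W ℓ).mulVec (nnLayer dims W bv x ℓ) i + bv ℓ i ≤ a)
    (nN : ℕ) (hnN : nN = ∑ ℓ ∈ Finset.range L, dims (ℓ + 1))
    (A : Matrix (Fin (dims 0)) (Fin (dims 0)) ℝ)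
    (B : Matrix (Fin (dims 0)) (Fin (dims (L + 1))) ℝ)
    (R : ℕ → Set (Fin (dims 0) → ℝ))
    (ng0 nb0 nc0 : ℕ)
    (G0c : Matrix (Fin (dims 0)) (Fin ng0) ℝ) (G0b : Matrix (Fin (dims 0)) (Fin nb0) ℝ)
    (c0 : Fin (dims 0) → ℝ)
    (A0c : Matrix (Fin nc0) (Fin ng0) ℝ) (A0b : Matrix (Fin nc0) (Fin nb0) ℝ)
    (b0 : Fin nc0 → ℝ)
    (hR0 : R 0 = hybZono G0c G0b c0 A0c A0b b0)
    (hrec : ∀ κ, R (κ + 1) =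
      { z | ∃ x ∈ R κ, z = A.mulVec x + B.mulVec (nnFun L dims W bv x) })
    (k : ℕ)
    (hbox : ∀ κ < k, ∀ x ∈ R κ, ∀ i, -a ≤ x i ∧ x i ≤ a) :
    ∃ (Gc : Matrix (Fin (k + 1) × Fin (dims 0)) (Fin (ng0 + 4 * k * nN)) ℝ)
      (Gb : Matrix (Fin (k + 1) × Fin (dims 0)) (Fin (nb0 + k * nN)) ℝ)
      (c : Fin (k + 1) × Fin (dims 0) → ℝ)
      (Ac : Matrix (Fin (nc0 + (dims 0 + 3 * nN) * (k * (k + 1) / 2)))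
        (Fin (ng0 + 4 * k * nN)) ℝ)
      (Ab : Matrix (Fin (nc0 + (dims 0 + 3 * nN) * (k * (k + 1) / 2)))
        (Fin (nb0 + k * nN)) ℝ)
      (b : Fin (nc0 + (dims 0 + 3 * nN) * (k * (k + 1) / 2)) → ℝ),
    { z : Fin (k + 1) × Fin (dims 0) → ℝ |
        ∃ x : Fin (k + 1) → Fin (dims 0) → ℝ,
          x 0 ∈ R 0 ∧
          (∀ κ : Fin k, x κ.succ =
            A.mulVec (x κ.castSucc) + B.mulVec (nnFun L dims W bv (x κ.castSucc))) ∧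
          z = fun p => x p.1 p.2 } =
    hybZono Gc Gb c Ac Ab b := by
  subst hnN
  set nN := ∑ ℓ ∈ Finset.range L, dims (ℓ + 1) with hnN
  let step : (Fin (dims 0) → ℝ) → (Fin (dims 0) → ℝ) :=
    fun x => A.mulVec x + B.mulVec (nnFun L dims W bv x)
  have hmem : ∀ x ∈ R 0, ∀ j, step^[j] x ∈ R j := by
    intro x hx j
    induction j with
    | zero => exact hx
    | succ j ih =>
      rw [hrec, Function.iterate_succ_apply']
      exact ⟨_, ih, rfl⟩
  have main : ∀ j ≤ k, HZ (ng0 + 4 * j * nN) (nb0 + j * nN) (nc0 + 3 * j * nN)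
      ((fun (x : Fin (dims 0) → ℝ) (p : Fin (j + 1) × Fin (dims 0)) =>
        step^[p.1.val] x p.2) '' R 0) := by
    intro j
    induction j with
    | zero =>
      intro _
      have h0 : HZ ng0 nb0 nc0 ((fun x : Fin (dims 0) → ℝ => x) '' R 0) := by
        rw [Set.image_id', hR0]
        exact HZ.of_hybZono _ _ _ _ _ _
      have h1 := h0.map (F := fun (p : Fin (0 + 1) × Fin (dims 0)) v => v p.2)
        (fun i => IsAff.proj _)
        (g' := fun (x : Fin (dims 0) → ℝ) (p : Fin (0 + 1) × Fin (dims 0)) =>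
          step^[p.1.val] x p.2) (by
          rintro t - ⟨i, i'⟩
          have : i.val = 0 := by omega
          simp [this])
      simpa using h1
    | succ j ih =>
      intro hj
      have ih := ih (by omega)
      have inner : ∀ ℓ ≤ L, HZ (ng0 + 4 * j * nN + 4 * ∑ l ∈ Finset.range ℓ, dims (l + 1))
          (nb0 + j * nN + ∑ l ∈ Finset.range ℓ, dims (l + 1))
          (nc0 + 3 * j * nN + 3 * ∑ l ∈ Finset.range ℓ, dims (l + 1))
          ((fun (x : Fin (dims 0) → ℝ) =>
            Sum.elim (fun (p : Fin (j + 1) × Fin (dims 0)) => step^[p.1.val] x p.2)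
              (nnLayer dims W bv (step^[j] x) ℓ)) '' R 0) := by
        intro ℓ
        induction ℓ with
        | zero =>
          intro _
          have := ih.map (F := Sum.elim (fun p v => v p)
            (fun (i : Fin (dims 0)) v => v (Fin.last j, i)))
            (by rintro (i | i) <;> exact IsAff.proj _)
            (g' := fun (x : Fin (dims 0) → ℝ) =>
              Sum.elim (fun (p : Fin (j + 1) × Fin (dims 0)) => step^[p.1.val] x p.2)
              (nnLayer dims W bv (step^[j] x) 0)) (by
                rintro t - (i | i)
                · rfl
                · simp [nnLayer])
          simpa using this
        | succ ℓ ihℓ =>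
          intro hℓ
          have h1 := (ihℓ (by omega)).relu
            (V := fun (i : Fin (dims (ℓ + 1))) v =>
              (W ℓ).mulVec (fun t => v (Sum.inr t)) i + bv ℓ i)
            (fun i => (IsAff.mulVec _ (fun t => IsAff.proj _) i).add (IsAff.const _)) ha
            (fun t ht i => hpre (step^[j] t) (hbox j (by omega) _ (hmem t ht j)) ℓ (by omega) i)
          have h2 := h1.map (F := Sum.elim (fun p v => v (Sum.inl (Sum.inl p)))
            (fun (i : Fin (dims (ℓ + 1))) v => v (Sum.inr i)))
            (by rintro (i | i) <;> exact IsAff.proj _)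
            (g' := fun (x : Fin (dims 0) → ℝ) =>
              Sum.elim (fun (p : Fin (j + 1) × Fin (dims 0)) => step^[p.1.val] x p.2)
              (nnLayer dims W bv (step^[j] x) (ℓ + 1))) (by
                rintro t - (i | i)
                · rfl
                · rfl)
          rw [Fintype.card_fin] at h2
          rw [Finset.sum_range_succ]
          convert h2 using 1 <;> ring
      have hL := inner L le_rfl
      rw [← hnN] at hL
      have h3 := hL.map (F := fun (p : Fin (j + 1 + 1) × Fin (dims 0)) v =>
          if h : p.1.val < j + 1 then v (Sum.inl (⟨p.1.val, h⟩, p.2)) else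
            A.mulVec (fun t => v (Sum.inl (Fin.last j, t))) p.2 +
            B.mulVec (fun t => (W L).mulVec (fun t' => v (Sum.inr t')) t + bv L t) p.2)
        (by
          rintro ⟨i, i'⟩
          by_cases h : i.val < j + 1
          · simp only [h, dite_true]; exact IsAff.proj _
          · simp only [h, dite_false]
            exact (IsAff.mulVec _ (fun t => IsAff.proj _) _).add
              (IsAff.mulVec _ (fun t =>
                (IsAff.mulVec _ (fun t => IsAff.proj _) _).add (IsAff.const _)) _))
        (g' := fun (x : Fin (dims 0) → ℝ) (p : Fin (j + 1 + 1) × Fin (dims 0)) =>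
          step^[p.1.val] x p.2) (by
          rintro t - ⟨i, i'⟩
          by_cases h : i.val < j + 1
          · simp only [h, dite_true]; rfl
          · have hi : i.val = j + 1 := by omega
            simp only [h, dite_false]
            rw [hi, Function.iterate_succ_apply']
            rfl)
      convert h3 using 1 <;> ring
  have hk := main k le_rfl
  have hle : nc0 + 3 * k * nN ≤ nc0 + (dims 0 + 3 * nN) * (k * (k + 1) / 2) := by
    have h1 : k ≤ k * (k + 1) / 2 := by
      rw [Nat.le_div_iff_mul_le (by norm_num)]
      rcases Nat.eq_zero_or_pos k with h | h
      · simp [h]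
      · exact Nat.mul_le_mul_left _ (by omega)
    have h2 : 3 * k * nN ≤ (dims 0 + 3 * nN) * (k * (k + 1) / 2) :=
      calc 3 * k * nN = (3 * nN) * k := by ring
        _ ≤ _ := Nat.mul_le_mul (by omega) h1
    omega
  have hset : { z : Fin (k + 1) × Fin (dims 0) → ℝ |
        ∃ x : Fin (k + 1) → Fin (dims 0) → ℝ,
          x 0 ∈ R 0 ∧
          (∀ κ : Fin k, x κ.succ =
            A.mulVec (x κ.castSucc) + B.mulVec (nnFun L dims W bv (x κ.castSucc))) ∧
          z = fun p => x p.1 p.2 } =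
      ((fun (x : Fin (dims 0) → ℝ) (p : Fin (k + 1) × Fin (dims 0)) =>
        step^[p.1.val] x p.2) '' R 0) := by
    ext z
    constructor
    · rintro ⟨x, h0, hx, rfl⟩
      refine ⟨x 0, h0, ?_⟩
      have : ∀ i : Fin (k + 1), step^[i.val] (x 0) = x i := by
        intro i
        induction i using Fin.induction with
        | zero => rfl
        | succ i ih =>
          rw [hx, Fin.val_succ, Function.iterate_succ_apply']
          rw [Fin.val_castSucc] at ih
          rw [ih]
      funext p
      simp only [this]
    · rintro ⟨x0, h0, rfl⟩
      refine ⟨fun i => step^[i.val] x0, h0, fun i => ?_, rfl⟩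
      simp only [Fin.val_succ, Function.iterate_succ_apply', Fin.val_castSucc]
      rfl
  rw [hset]
  exact (hk.pad hle).to_hybZono
end
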